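/- Let $A \in \mathbb{R}^{N \times N}$, $B \in \mathbb{R}^{N \times q}$, $G_c \in \mathbb{R}^{N \times s}$, let $G$ be symmetric positive definite, and suppose there exist $\beta \geq 1$ and $\alpha < 0$ with $\lVert e^{At} \rVert_G \leq \beta e^{\alpha t}$ for all $t \geq 0$. Let $\tau > 0$, $\underline{t} = t_0 - 2\tau$, let $\epsilon(\underline{t})$ satisfy $\lVert \epsilon(\underline{t}) \rVert_G \leq \eta_{\underline{t}}$, and let $r: [\underline{t}, \infty) \to \mathbb{R}^q$ and $\omega: [\underline{t}, \infty) \to \mathbb{R}^s$ be measurable functions with $\lVert B r(s) \rVert_G \leq C_r$ and $\lVert G_c \omega(s) \rVert_G \leq C_\omega$ for all $s \geq \underline{t}$. Define, for $t \geq \underline{t} + \tau$, $\epsilon^{(1)}(t) = e^{A(t - \underline{t})}\epsilon(\underline{t}) + \int_{\underline{t}}^{t-\tau} e^{A(t-s)}(B r(s) + G_c \omega(s))\, ds$. Then for all $t \geq t_0$: $\lVert \epsilon^{(1)}(t) \rVert_G \leq \beta e^{2\alpha\tau} \eta_{\underline{t}} + \frac{\beta e^{\alpha\tau}(C_r + C_\omega)}{-\alpha}$.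 -/

import Mathlib

open Matrix MeasureTheory

/-- Weighted norm `‖x‖_G = √(xᵀ G x)` for a positive definite weighting matrix `G`. -/
noncomputable def normG {N : ℕ} (G : Matrix (Fin N) (Fin N) ℝ) (x : Fin N → ℝ) : ℝ :=
  Real.sqrt (x ⬝ᵥ G.mulVec x)

/-- Induced weighted matrix norm `‖A‖_G = sup_{x ≠ 0} ‖Ax‖_G / ‖x‖_G`. -/
noncomputable def matNormG {N : ℕ} (G A : Matrix (Fin N) (Fin N) ℝ) : ℝ :=
  sSup {c | ∃ x : Fin N → ℝ, x ≠ 0 ∧ c = normG G (A.mulVec x) / normG G x}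

open scoped MatrixOrder Matrix.Norms.L2Operator in
theorem exists_continuousLinearEquiv_normG_eq {N : ℕ} {G : Matrix (Fin N) (Fin N) ℝ}
    (hG : G.PosDef) :
    ∃ L : (Fin N → ℝ) ≃L[ℝ] EuclideanSpace ℝ (Fin N), ∀ x, normG G x = ‖L x‖ := by
  obtain ⟨S, hS, rfl⟩ := CStarAlgebra.isStrictlyPositive_iff_eq_star_mul_self.mp
    hG.isStrictlyPositive
  refine ⟨(S.toLinearEquiv' (S.invertibleOfIsUnitDet
    ((Matrix.isUnit_iff_isUnit_det S).mp hS))).toContinuousLinearEquiv.trans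
      (EuclideanSpace.equiv (Fin N) ℝ).symm, fun x => ?_⟩
  have h : x ⬝ᵥ (star S * S) *ᵥ x = ∑ i, (S *ᵥ x) i ^ 2 := by
    rw [← Matrix.mulVec_mulVec, Matrix.dotProduct_mulVec, Matrix.star_eq_conjTranspose,
      Matrix.conjTranspose_eq_transpose_of_trivial, Matrix.vecMul_transpose]
    simp [dotProduct, sq]
  rw [normG, h, EuclideanSpace.norm_eq]
  congr 1
  refine Finset.sum_congr rfl fun i _ => ?_
  rw [Real.norm_eq_abs, sq_abs]
  rfl

theorem normG_mulVec_le {N : ℕ} {G : Matrix (Fin N) (Fin N) ℝ} (hG : G.PosDef)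
    (A : Matrix (Fin N) (Fin N) ℝ) (x : Fin N → ℝ) :
    normG G (A *ᵥ x) ≤ matNormG G A * normG G x := by
  obtain ⟨L, hL⟩ := exists_continuousLinearEquiv_normG_eq hG
  rcases eq_or_ne x 0 with rfl | hx
  · simp [normG]
  have hpos : ∀ y : Fin N → ℝ, y ≠ 0 → 0 < normG G y := fun y hy => by
    rw [hL]
    exact norm_pos_iff.mpr (by simpa using hy)
  rw [← div_le_iff₀ (hpos x hx)]
  refine le_csSup ⟨‖(L : (Fin N → ℝ) →L[ℝ] EuclideanSpace ℝ (Fin N)) ∘L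
    LinearMap.toContinuousLinearMap A.mulVecLin ∘L
      (L.symm : EuclideanSpace ℝ (Fin N) →L[ℝ] (Fin N → ℝ))‖, ?_⟩ ⟨x, hx, rfl⟩
  rintro _ ⟨y, hy, rfl⟩
  rw [div_le_iff₀ (hpos y hy), hL, hL]
  refine le_of_eq_of_le ?_ (ContinuousLinearMap.le_opNorm _ (L y))
  simp

theorem integral_exp_mul_sub_le {α : ℝ} (hα : α < 0) (a t τ : ℝ) :
    ∫ u in a..(t - τ), Real.exp (α * (t - u)) ≤ Real.exp (α * τ) / (-α) := by
  have hderiv : ∀ u ∈ Set.uIcc a (t - τ), HasDerivAt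
      (fun u => Real.exp (α * (t - u)) / (-α)) (Real.exp (α * (t - u))) u := fun u _ => by
    have h := ((((hasDerivAt_id u).const_sub t).const_mul α).exp).div_const (-α)
    refine h.congr_deriv ?_
    have := hα.ne
    simp only [id]
    field_simp
  rw [intervalIntegral.integral_eq_sub_of_hasDerivAt hderiv
    (Continuous.intervalIntegrable (by fun_prop) _ _), sub_sub_cancel]
  have : 0 ≤ Real.exp (α * (t - a)) / (-α) := div_nonneg (Real.exp_nonneg _) (by linarith)
  linarith

/-- **Continuous-time bound on `ε⁽¹⁾(t)` (equation (27) of the paper).**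
With `‖e^{At}‖_G ≤ β e^{αt}` for all `t ≥ 0` (`β ≥ 1`, `α < 0`),
`‖ε(t̲)‖_G ≤ η_t̲`, and `‖B r(s)‖_G ≤ C_r`, `‖G_c ω(s)‖_G ≤ C_ω` for all
`s ≥ t̲ = t₀ - 2τ`, the term
`ε⁽¹⁾(t) = e^{A(t-t̲)} ε(t̲) + ∫_{t̲}^{t-τ} e^{A(t-s)} (B r(s) + G_c ω(s)) ds`
satisfies, for all `t ≥ t₀`,
`‖ε⁽¹⁾(t)‖_G ≤ β e^{2ατ} η_t̲ + β e^{ατ} (C_r + C_ω) / (-α)`. -/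
theorem eps1_bound_continuous_time
    (N q s : ℕ)
    (Aeps : Matrix (Fin N) (Fin N) ℝ) (B : Matrix (Fin N) (Fin q) ℝ)
    (Gc : Matrix (Fin N) (Fin s) ℝ)
    (G : Matrix (Fin N) (Fin N) ℝ) (hGsymm : G.IsSymm) (hGpd : G.PosDef)
    (β α : ℝ) (hβ : 1 ≤ β) (hα : α < 0)
    (hA : ∀ t : ℝ, 0 ≤ t →
      matNormG G (NormedSpace.exp (t • Aeps)) ≤ β * Real.exp (α * t))
    (τ t₀ tund : ℝ) (hτ : 0 < τ) (htund : tund = t₀ - 2 * τ)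
    (εinit : Fin N → ℝ) (η : ℝ) (hinit : normG G εinit ≤ η)
    (r : ℝ → Fin q → ℝ) (ω : ℝ → Fin s → ℝ)
    (hrmeas : Measurable r) (hωmeas : Measurable ω)
    (Cr Cω : ℝ)
    (hCr : ∀ u ≥ tund, normG G (B.mulVec (r u)) ≤ Cr)
    (hCω : ∀ u ≥ tund, normG G (Gc.mulVec (ω u)) ≤ Cω) :
    ∀ t ≥ t₀,
      normG G ((NormedSpace.exp ((t - tund) • Aeps)).mulVec εinit +
        ∫ u in tund..(t - τ),
          (NormedSpace.exp ((t - u) • Aeps)).mulVec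
            (B.mulVec (r u) + Gc.mulVec (ω u))) ≤
      β * Real.exp (α * (2 * τ)) * η + β * Real.exp (α * τ) * (Cr + Cω) / (-α) := by
  intro t ht
  obtain ⟨L, hL⟩ := exists_continuousLinearEquiv_normG_eq hGpd
  have hβ0 : 0 ≤ β := zero_le_one.trans hβ
  have hη : 0 ≤ η := (Real.sqrt_nonneg _).trans hinit
  have hC : 0 ≤ Cr + Cω := add_nonneg ((Real.sqrt_nonneg _).trans (hCr tund le_rfl))
    ((Real.sqrt_nonneg _).trans (hCω tund le_rfl))
  have hexp : ∀ (u : ℝ) (x : Fin N → ℝ) (c : ℝ), 0 ≤ u → normG G x ≤ c →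
      normG G (NormedSpace.exp (u • Aeps) *ᵥ x) ≤ β * Real.exp (α * u) * c :=
    fun u x c hu hx => (normG_mulVec_le hGpd _ x).trans
      (mul_le_mul (hA u hu) hx (Real.sqrt_nonneg _) (by positivity))
  have hfree : normG G (NormedSpace.exp ((t - tund) • Aeps) *ᵥ εinit) ≤
      β * Real.exp (α * (2 * τ)) * η := by
    refine (hexp _ _ η (by linarith) hinit).trans ?_
    have : α * (t - tund) ≤ α * (2 * τ) := mul_le_mul_of_nonpos_left (by linarith) hα.le
    gcongr
  have hforced : normG G (∫ u in tund..(t - τ), NormedSpace.exp ((t - u) • Aeps) *ᵥ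
      (B *ᵥ r u + Gc *ᵥ ω u)) ≤ β * Real.exp (α * τ) * (Cr + Cω) / (-α) := by
    rw [hL, intervalIntegral.integral_of_le (by linarith), ← L.integral_comp_comm,
      ← intervalIntegral.integral_of_le (by linarith)]
    calc _ ≤ ∫ u in tund..(t - τ), β * (Cr + Cω) * Real.exp (α * (t - u)) := by
          refine intervalIntegral.norm_integral_le_of_norm_le (by linarith)
            (Filter.Eventually.of_forall fun u hu => ?_)
            (Continuous.intervalIntegrable (by fun_prop) _ _)
          rw [← hL, mul_right_comm]
          refine hexp _ _ _ (by linarith [hu.2]) ?_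
          have h₁ := hCr u hu.1.le
          have h₂ := hCω u hu.1.le
          rw [hL] at h₁ h₂ ⊢
          rw [map_add]
          exact norm_add_le_of_le h₁ h₂
      _ ≤ β * (Cr + Cω) * (Real.exp (α * τ) / (-α)) := by
          rw [intervalIntegral.integral_const_mul]
          gcongr
          exact integral_exp_mul_sub_le hα _ _ _
      _ = _ := by ring
  rw [hL] at hfree hforced ⊢
  rw [map_add]
  exact norm_add_le_of_le hfree hforced
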